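/- arXiv:0706.2595 — 2 statements merged into one kernel-verified Lean document; each statement's English description precedes it below -/
import Mathlib

section
/- Let n ≥ 1 and let A be an n×n real matrix whose operator norm satisfies ‖A‖ < 2π. Then det( ∑_{k=0}^∞ (1/(4^k·(2k+1)!))·A^{2k} ) > 0 and log det( ∑_{k=0}^∞ (1/(4^k·(2k+1)!))·A^{2k} ) = ∑_{k=1}^∞ ( b_{2k} / ((2k)!·2k) ) · tr(A^{2k}), where the right-hand series converges absolutely. -/
attribute [local instance] Matrix.linftyOpNormedAddCommGroup Matrix.linftyOpNormedRing
  Matrix.linftyOpNormedAlgebra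

lemma hasDerivAt_det_one_add {n : ℕ} (M : Matrix (Fin n) (Fin n) ℝ) :
    HasDerivAt (fun t : ℝ => (1 + t • M).det) M.trace 0 := by
  have h := (Matrix.det (1 + (Polynomial.X : Polynomial ℝ) • M.map Polynomial.C)).hasDerivAt 0
  rw [Matrix.derivative_det_one_add_X_smul] at h
  refine h.congr_of_eventuallyEq (Filter.Eventually.of_forall fun t => ?_)
  beta_reduce
  rw [← Polynomial.coe_evalRingHom, RingHom.map_det]
  congr 1
  ext i j
  simp [Matrix.one_apply, apply_ite]
  ring

lemma differentiable_det {n : ℕ} :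
    Differentiable ℝ (fun M : Matrix (Fin n) (Fin n) ℝ => M.det) := by
  have he : ∀ i j, Differentiable ℝ (fun M : Matrix (Fin n) (Fin n) ℝ => M i j) := by
    intro i j
    exact (LinearMap.toContinuousLinearMap (Matrix.entryLinearMap ℝ ℝ i j)).differentiable
  simp_rw [Matrix.det_apply]
  fun_prop

lemma det_exp_real {n : ℕ} (M : Matrix (Fin n) (Fin n) ℝ) :
    (NormedSpace.exp M).det = Real.exp M.trace := by
  have hd1 : HasFDerivAt (fun M : Matrix (Fin n) (Fin n) ℝ => M.det)
      (fderiv ℝ (fun M : Matrix (Fin n) (Fin n) ℝ => M.det) 1) 1 :=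
    differentiable_det.differentiableAt.hasFDerivAt
  have hlin : HasDerivAt (fun t : ℝ => 1 + t • M) M 0 := by
    have := ((hasDerivAt_id (0:ℝ)).smul_const M).const_add 1
    rw [one_smul] at this
    exact this
  have e1 : fderiv ℝ (fun M : Matrix (Fin n) (Fin n) ℝ => M.det) 1 M = M.trace := by
    have h1 : HasFDerivAt (fun M : Matrix (Fin n) (Fin n) ℝ => M.det)
      (fderiv ℝ (fun M : Matrix (Fin n) (Fin n) ℝ => M.det) 1) (1 + (0:ℝ) • M) := by
        simpa using hd1
    exact (h1.comp_hasDerivAt (0:ℝ) hlin).unique (hasDerivAt_det_one_add M)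
  have hexp : HasDerivAt (fun t : ℝ => NormedSpace.exp (t • M)) M 0 := by
    have := hasDerivAt_exp_smul_const (𝕂 := ℝ) M (0:ℝ)
    rw [zero_smul, NormedSpace.exp_zero, one_mul] at this
    exact this
  have h0 : HasDerivAt (fun t : ℝ => (NormedSpace.exp (t • M)).det) M.trace 0 := by
    have h1 : HasFDerivAt (fun M : Matrix (Fin n) (Fin n) ℝ => M.det)
      (fderiv ℝ (fun M : Matrix (Fin n) (Fin n) ℝ => M.det) 1) (NormedSpace.exp ((0:ℝ) • M)) := by
        simpa using hd1
    have := h1.comp_hasDerivAt (0:ℝ) hexp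
    exact e1 ▸ this
  have ht : ∀ t : ℝ, HasDerivAt (fun t : ℝ => (NormedSpace.exp (t • M)).det)
      ((NormedSpace.exp (t • M)).det * M.trace) t := by
    intro t
    have h2 : HasDerivAt (fun s : ℝ => (NormedSpace.exp ((s - t) • M)).det) M.trace t := by
      have := HasDerivAt.comp_sub_const t t (f := fun t : ℝ => (NormedSpace.exp (t • M)).det) (f' := M.trace) (by simpa using h0)
      exact this
    have h3 := h2.const_mul ((NormedSpace.exp (t • M)).det)
    refine h3.congr_of_eventuallyEq (Filter.Eventually.of_forall fun s => ?_)
    beta_reduce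
    rw [← Matrix.det_mul, ← Matrix.exp_add_of_commute]
    · congr 2
      rw [← add_smul]; congr 1; ring
    · exact ((Commute.refl M).smul_left t).smul_right (s - t)
  have hc : ∀ t : ℝ, HasDerivAt (fun t : ℝ => (NormedSpace.exp (t • M)).det * Real.exp (-(t * M.trace))) 0 t := by
    intro t
    have h4 : HasDerivAt (fun t : ℝ => Real.exp (-(t * M.trace))) (Real.exp (-(t * M.trace)) * (-(1 * M.trace))) t :=
      (((hasDerivAt_id t).mul_const M.trace).neg).exp
    refine ((ht t).mul h4).congr_deriv ?_
    ring
  have := is_const_of_deriv_eq_zero (fun t => (hc t).differentiableAt) (fun t => (hc t).deriv) 1 0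
  simp only [one_smul, zero_smul, NormedSpace.exp_zero, Matrix.det_one, one_mul, zero_mul, neg_zero, Real.exp_zero, Real.exp_neg] at this
  field_simp at this
  exact this
noncomputable def fS : PowerSeries ℝ := PowerSeries.mk fun k => if Even k then 1 / (2 ^ k * ((k+1).factorial : ℝ)) else 0
noncomputable def gS : PowerSeries ℝ := PowerSeries.mk fun k => if Even k ∧ k ≠ 0 then (bernoulli k : ℝ) / (k.factorial * k) else 0

open PowerSeries in
lemma formal_ode : PowerSeries.derivative ℝ fS = PowerSeries.derivative ℝ gS * fS := by
  set E : PowerSeries ℝ := rescale (1/2 : ℝ) (exp ℝ) with hE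
  set E' : PowerSeries ℝ := rescale (-1/2 : ℝ) (exp ℝ) with hE'
  have hEE : E * E' = 1 := by
    rw [hE, hE', exp_mul_exp_eq_exp_add]
    norm_num
  have hE2 : E * E = exp ℝ := by
    rw [hE, exp_mul_exp_eq_exp_add]
    norm_num
  have hXf : X * fS = E - E' := by
    ext k
    rcases k with _ | k
    · rw [coeff_zero_X_mul, map_sub, hE, hE', coeff_rescale, coeff_rescale]; simp
    · rw [coeff_succ_X_mul]
      simp only [fS, coeff_mk, hE, hE', map_sub, coeff_rescale, coeff_exp]
      split_ifs with h
      · rw [neg_div, Odd.neg_pow (by exact h.add_one)]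
        simp
        field_simp
        ring
      · have : Even (k+1) := by grind
        rw [neg_div, Even.neg_pow this]; ring
  have dE : derivative ℝ E = C (1/2) * E := by
    ext k
    simp only [hE, coeff_derivative, coeff_rescale, coeff_exp, coeff_C_mul, Nat.factorial_succ]
    simp
    field_simp
    ring
  have dE' : derivative ℝ E' = - C (1/2) * E' := by
    ext k
    simp only [hE', coeff_derivative, coeff_rescale, coeff_exp, coeff_C_mul, Nat.factorial_succ, neg_mul, map_neg]
    simp
    field_simp
    ring
  have hd : fS + X * derivative ℝ fS = C (1/2) * (E + E') := by
    have := congrArg (derivative ℝ) hXf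
    rw [Derivation.leibniz, map_sub, dE, dE', derivative_X] at this
    simp only [smul_eq_mul, mul_one] at this
    linear_combination this
  have hP := bernoulliPowerSeries_mul_exp_sub_one ℝ
  have hg : X * derivative ℝ gS = bernoulliPowerSeries ℝ - 1 + C (1/2) * X := by
    ext k
    rcases k with _ | _ | k
    · simp [bernoulliPowerSeries]
    · rw [coeff_succ_X_mul]
      simp [bernoulliPowerSeries, coeff_derivative, gS, coeff_one]
      norm_num
    · rw [coeff_succ_X_mul]
      simp only [bernoulliPowerSeries, coeff_derivative, gS, coeff_one, coeff_mk, map_add, map_sub, coeff_C_mul, coeff_X]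
      rw [if_neg (by omega : ¬ (k + 1 + 1 = 0)), if_neg (by omega : ¬ (k + 1 + 1 = 1))]
      split_ifs with h
      · simp
        field_simp
      · have : Odd (k+1+1) := by
          rw [← Nat.not_even_iff_odd]; intro h'; exact h ⟨h', by omega⟩
        simp [bernoulli_eq_zero_of_odd this (by omega)]
  have hX : (X : PowerSeries ℝ) ≠ 0 := X_ne_zero
  have hfP : fS * bernoulliPowerSeries ℝ = E' := by
    apply mul_left_cancel₀ hX
    linear_combination (E' * hP) + (bernoulliPowerSeries ℝ) * hXf - (bernoulliPowerSeries ℝ) * (E * hEE) + (bernoulliPowerSeries ℝ) * E' * hE2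
  have hC : (C (1/2) : PowerSeries ℝ) * 2 = 1 := by
    have : (2 : PowerSeries ℝ) = C 2 := by exact (map_ofNat C 2).symm
    rw [this, ← map_mul]; norm_num
  apply mul_left_cancel₀ hX
  linear_combination hd - fS * hg - hfP - (C (1/2)) * hXf + E' * hC

section Banach
open PowerSeries

/-- Linear growth bound on rescaled coefficients. -/
def GrowthLe (p : PowerSeries ℝ) (R : ℝ) : Prop := ∃ C : ℝ, ∀ k : ℕ, |coeff k p| * R ^ k ≤ C * (k + 1)

lemma GrowthLe.summable {𝔸 : Type*} [NormedRing 𝔸] [NormedAlgebra ℝ 𝔸] {p : PowerSeries ℝ} {R : ℝ}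
    (hp : GrowthLe p R) {z : 𝔸} (hz : ‖z‖ < R) : Summable fun k => ‖coeff k p • z ^ k‖ := by
  obtain ⟨C, hC⟩ := hp
  have hR : 0 < R := (norm_nonneg z).trans_lt hz
  have hq0 : 0 ≤ ‖z‖ / R := by positivity
  have hq : ‖(‖z‖ / R)‖ < 1 := by
    rw [Real.norm_of_nonneg hq0]; exact (div_lt_one hR).2 hz
  have h1 := summable_pow_mul_geometric_of_norm_lt_one 1 hq
  have h0 := summable_pow_mul_geometric_of_norm_lt_one 0 hq
  have hs : Summable fun k : ℕ => (C * (‖(1:𝔸)‖ + 1)) * (((k:ℝ)+1) * (‖z‖/R)^k) := by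
    refine ((h1.add h0).congr fun k => ?_).mul_left _
    simp; ring
  refine Summable.of_nonneg_of_le (fun k => norm_nonneg _) (fun k => ?_) hs
  have hzk : ‖z ^ k‖ ≤ (‖(1:𝔸)‖ + 1) * ‖z‖ ^ k := by
    rcases k with _ | k
    · simp
    · refine (norm_pow_le' z k.succ_pos).trans ?_
      have : 0 ≤ ‖(1:𝔸)‖ * ‖z‖ ^ (k+1) := by positivity
      simp only [Nat.succ_eq_add_one]
      linarith
  calc ‖coeff k p • z ^ k‖ ≤ |coeff k p| * ‖z ^ k‖ := by
        simpa using norm_smul_le (coeff k p) (z ^ k)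
    _ ≤ |coeff k p| * ((‖(1:𝔸)‖ + 1) * ‖z‖ ^ k) := by gcongr
    _ = (|coeff k p| * R ^ k) * ((‖(1:𝔸)‖ + 1) * (‖z‖ / R) ^ k) := by
        rw [div_pow]; field_simp
    _ ≤ (C * (k+1)) * ((‖(1:𝔸)‖ + 1) * (‖z‖ / R) ^ k) := by
        exact mul_le_mul_of_nonneg_right (hC k) (by positivity)
    _ = _ := by ring

lemma growthLe_of_bdd {p : PowerSeries ℝ} {R C : ℝ} (hR : 0 < R) (h : ∀ k, |coeff k p| * R ^ k ≤ C) :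
    GrowthLe p R := by
  refine ⟨C, fun k => (h k).trans ?_⟩
  have hC : 0 ≤ C := le_trans (by positivity) (h 0)
  nlinarith [mul_nonneg hC (Nat.cast_nonneg (α := ℝ) k)]

lemma growthLe_deriv {p : PowerSeries ℝ} {R C : ℝ} (hR : 0 < R) (h : ∀ k, |coeff k p| * R ^ k ≤ C) :
    GrowthLe (derivative ℝ p) R := by
  refine ⟨C / R, fun k => ?_⟩
  rw [coeff_derivative, abs_mul, abs_of_nonneg (by positivity : (0:ℝ) ≤ k + 1)]
  have := h (k+1)
  rw [div_mul_eq_mul_div, le_div_iff₀ hR]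
  calc _ = (|coeff (k+1) p| * R ^ (k+1)) * (k+1) := by ring
    _ ≤ _ := by gcongr

variable {𝔸 : Type*} [NormedCommRing 𝔸] [NormedAlgebra ℝ 𝔸] [CompleteSpace 𝔸]

lemma ev_mul {p q : PowerSeries ℝ} {R : ℝ} (hp : GrowthLe p R) (hq : GrowthLe q R) {z : 𝔸}
    (hz : ‖z‖ < R) :
    ∑' k, coeff k (p * q) • z ^ k = (∑' k, coeff k p • z ^ k) * ∑' k, coeff k q • z ^ k := by
  rw [tsum_mul_tsum_eq_tsum_sum_antidiagonal_of_summable_norm (hp.summable hz) (hq.summable hz)]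
  refine tsum_congr fun k => ?_
  rw [coeff_mul, Finset.sum_smul]
  refine Finset.sum_congr rfl fun x hx => ?_
  rw [smul_mul_smul_comm, ← pow_add, Finset.HasAntidiagonal.mem_antidiagonal.1 hx]

lemma ev_hasDerivAt {p : PowerSeries ℝ} {R C : ℝ} (hR : 0 < R) (h : ∀ k, |coeff k p| * R ^ k ≤ C)
    (a : 𝔸) {ρ : ℝ} (hρ : 0 < ρ) (hρa : ρ * ‖a‖ < R) {t : ℝ} (ht : t ∈ Set.Ioo (-ρ) ρ) :
    HasDerivAt (fun s : ℝ => ∑' k, coeff k p • (s • a) ^ k)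
      (a * ∑' k, coeff k (derivative ℝ p) • (t • a) ^ k) t := by
  have hd := growthLe_deriv hR h
  have hnorm : ∀ s ∈ Set.Ioo (-ρ) ρ, ‖s • a‖ < R := by
    intro s hs
    refine lt_of_le_of_lt (norm_smul_le s a) (lt_of_le_of_lt ?_ hρa)
    gcongr
    exact (abs_lt.2 hs).le
  set u : ℕ → ℝ := fun k => |coeff k p| * (k * ρ ^ (k-1)) * ‖a ^ k‖ with hu
  have hus : Summable u := by
    rw [← summable_nat_add_iff 1]
    have h1 := (hd.summable (z := ρ * ‖a‖) (by rwa [Real.norm_of_nonneg (by positivity)])).mul_left ‖a‖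
    refine Summable.of_nonneg_of_le (fun k => by positivity) (fun k => ?_) h1
    simp only [hu, Nat.add_sub_cancel]
    have := norm_pow_le' a k.succ_pos
    calc _ ≤ |coeff (k+1) p| * (((k+1:ℕ):ℝ) * ρ ^ k) * ‖a‖ ^ (k+1) := by gcongr
      _ = _ := by
        rw [coeff_derivative, norm_smul, norm_mul, Real.norm_eq_abs, Real.norm_of_nonneg (by positivity : (0:ℝ) ≤ (k:ℝ)+1), Real.norm_of_nonneg (by positivity : (0:ℝ) ≤ (ρ * ‖a‖)^k)]
        push_cast; ring
  have key := hasDerivAt_tsum_of_isPreconnected (𝕜 := ℝ) (g := fun k (s:ℝ) => coeff k p • (s • a) ^ k)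
    (g' := fun k (s:ℝ) => coeff k p • ((k * s ^ (k-1)) • a ^ k)) (t := Set.Ioo (-ρ) ρ) (y₀ := t) (y := t)
    hus isOpen_Ioo isPreconnected_Ioo ?_ ?_ ht ?_ ht
  · refine key.congr_deriv ?_
    rw [Summable.tsum_eq_zero_add]
    · simp only [Nat.cast_zero, zero_mul, zero_smul, smul_zero, zero_add]
      rw [← Summable.tsum_mul_left]
      · refine tsum_congr fun k => ?_
        rw [coeff_derivative, smul_pow, pow_succ']
        simp only [Nat.add_sub_cancel, smul_smul, mul_smul_comm]
        congr 1
        push_cast; ring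
      · exact (hd.summable (hnorm t ht)).of_norm
    · refine Summable.of_norm_bounded hus fun k => ?_
      refine (norm_smul_le _ _).trans ?_
      rw [hu]
      beta_reduce
      rw [mul_assoc, Real.norm_eq_abs]
      gcongr
      refine (norm_smul_le _ _).trans ?_
      gcongr
      rw [norm_mul, norm_pow]
      simp only [RCLike.norm_natCast]
      gcongr
      exact (abs_lt.2 ht).le
  · intro k s hs
    simp_rw [smul_pow]
    exact ((hasDerivAt_pow k s).smul_const (a ^ k)).const_smul (coeff k p)
  · intro k s hs
    refine (norm_smul_le _ _).trans ?_
    rw [hu]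
    beta_reduce
    rw [mul_assoc, Real.norm_eq_abs]
    gcongr
    refine (norm_smul_le _ _).trans ?_
    gcongr
    rw [norm_mul, norm_pow]
    simp only [RCLike.norm_natCast]
    gcongr
    exact (abs_lt.2 hs).le
  · exact ((growthLe_of_bdd hR h).summable (hnorm t ht)).of_norm

lemma ev_eq_exp {f g : PowerSeries ℝ} {R C D : ℝ} (hf : ∀ k, |coeff k f| * R ^ k ≤ C)
    (hg : ∀ k, |coeff k g| * R ^ k ≤ D) (hf0 : coeff 0 f = 1) (hg0 : coeff 0 g = 0)
    (hode : derivative ℝ f = derivative ℝ g * f) (a : 𝔸) (ha : ‖a‖ < R) :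
    ∑' k, coeff k f • a ^ k = NormedSpace.exp (∑' k, coeff k g • a ^ k) := by
  have hR : 0 < R := (norm_nonneg a).trans_lt ha
  obtain ⟨ρ, hρ1, hρa⟩ : ∃ ρ : ℝ, 1 < ρ ∧ ρ * ‖a‖ < R := by
    refine ⟨2 * R / (R + ‖a‖), ?_, ?_⟩
    · rw [one_lt_div (by positivity)]; linarith
    · rw [div_mul_eq_mul_div, div_lt_iff₀ (by positivity)]
      nlinarith
  have hρ : 0 < ρ := by linarith
  set F : ℝ → 𝔸 := fun s : ℝ => ∑' k, coeff k f • (s • a) ^ k with hF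
  set G : ℝ → 𝔸 := fun s : ℝ => ∑' k, coeff k g • (s • a) ^ k with hG
  have hder : ∀ t ∈ Set.Ioo (-ρ) ρ, HasDerivAt (fun s => F s * NormedSpace.exp (-G s)) 0 t := by
    intro t ht
    have hn : ‖t • a‖ < R := by
      refine lt_of_le_of_lt (norm_smul_le t a) (lt_of_le_of_lt ?_ hρa)
      gcongr
      exact (abs_lt.2 ht).le
    have h1 := ev_hasDerivAt hR hf a hρ hρa ht
    have h2 := ev_hasDerivAt hR hg a hρ hρa ht
    rw [hode, ev_mul (growthLe_deriv hR hg) (growthLe_of_bdd hR hf) hn] at h1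
    have h3 := (hasFDerivAt_exp (𝕂 := ℝ) (x := -G t)).comp_hasDerivAt t h2.neg
    refine (h1.mul h3).congr_deriv ?_
    simp only [smul_apply, one_apply_eq_self, Pi.neg_apply, smul_eq_mul, Function.comp, hG]
    ring
  have hconst := isOpen_Ioo.is_const_of_deriv_eq_zero (s := Set.Ioo (-ρ) ρ) (𝕜 := ℝ) isPreconnected_Ioo
    (f := fun s => F s * NormedSpace.exp (-G s))
    (fun t ht => (hder t ht).differentiableAt.differentiableWithinAt)
    (fun t ht => (hder t ht).deriv) (x := 1) (y := 0) (by constructor <;> linarith) (by constructor <;> linarith)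
  have z (p : PowerSeries ℝ) : ∑' k, coeff k p • ((0:ℝ) • a) ^ k = algebraMap ℝ 𝔸 (coeff 0 p) := by
    rw [tsum_eq_single 0]
    · simp [Algebra.algebraMap_eq_smul_one]
    · intro k hk; simp [hk]
  have hF0 : F 0 = 1 := by rw [hF]; beta_reduce; rw [z, hf0, map_one]
  have hG0 : G 0 = 0 := by rw [hG]; beta_reduce; rw [z, hg0, map_zero]
  have hF1 : F 1 = ∑' k, coeff k f • a ^ k := by simp [hF]
  have hG1 : G 1 = ∑' k, coeff k g • a ^ k := by simp [hG]
  simp only [hF0, hG0, neg_zero, NormedSpace.exp_zero, mul_one] at hconst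
  rw [← hF1, ← hG1]
  let _ : NormedAlgebra ℚ 𝔸 := NormedAlgebra.restrictScalars ℚ ℝ 𝔸
  have he : NormedSpace.exp (-G 1) * NormedSpace.exp (G 1) = 1 := by
    rw [← NormedSpace.exp_add, neg_add_cancel, NormedSpace.exp_zero]
  calc F 1 = F 1 * (NormedSpace.exp (-G 1) * NormedSpace.exp (G 1)) := by rw [he, mul_one]
    _ = _ := by rw [← mul_assoc, hconst, one_mul]

lemma ev_eq_exp_map {𝔹 : Type*} [NormedRing 𝔹] [NormedAlgebra ℝ 𝔹]
    {f g : PowerSeries ℝ} {R C D : ℝ} (hf : ∀ k, |coeff k f| * R ^ k ≤ C)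
    (hg : ∀ k, |coeff k g| * R ^ k ≤ D) (hf0 : coeff 0 f = 1) (hg0 : coeff 0 g = 0)
    (hode : derivative ℝ f = derivative ℝ g * f) (a : 𝔸) (ha : ‖a‖ < R)
    (φ : 𝔸 →ₐ[ℝ] 𝔹) (hc : Continuous φ) :
    ∑' k, coeff k f • (φ a) ^ k = NormedSpace.exp (∑' k, coeff k g • (φ a) ^ k) := by
  have hR : 0 < R := (norm_nonneg a).trans_lt ha
  have key := ev_eq_exp hf hg hf0 hg0 hode a ha
  have hmap (p : PowerSeries ℝ) (hp : GrowthLe p R) :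
      φ (∑' k, PowerSeries.coeff k p • a ^ k) = ∑' k, PowerSeries.coeff k p • (φ a) ^ k := by
    rw [Summable.map_tsum (hp.summable ha).of_norm φ hc]
    simp
  have h2 := congrArg φ key
  let _ : NormedAlgebra ℚ 𝔸 := NormedAlgebra.restrictScalars ℚ ℝ 𝔸
  let _ : NormedAlgebra ℚ 𝔹 := NormedAlgebra.restrictScalars ℚ ℝ 𝔹
  rw [hmap _ (growthLe_of_bdd hR hf), NormedSpace.map_exp φ hc, hmap _ (growthLe_of_bdd hR hg)] at h2
  exact h2
end Banach

lemma fS_bound (k : ℕ) : |PowerSeries.coeff k fS| * (2 * Real.pi) ^ k ≤ Real.exp Real.pi := by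
  have hpi := Real.pi_pos
  simp only [fS, PowerSeries.coeff_mk]
  split_ifs
  · rw [abs_of_nonneg (by positivity)]
    calc _ = Real.pi ^ k / (k+1).factorial := by rw [mul_pow]; field_simp
      _ ≤ Real.pi ^ k / k.factorial := by
        gcongr; omega
      _ ≤ _ := Real.pow_div_factorial_le_exp _ hpi.le k
  · simp; positivity

lemma gS_bound : ∃ C, ∀ k : ℕ, |PowerSeries.coeff k gS| * (2 * Real.pi) ^ k ≤ C := by
  have hpi := Real.pi_pos
  refine ⟨2 * ∑' n : ℕ, 1 / (n:ℝ) ^ (2 * 1), fun k => ?_⟩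
  have hs := (hasSum_zeta_nat one_ne_zero).summable
  simp only [gS, PowerSeries.coeff_mk]
  split_ifs with h
  · obtain ⟨⟨m, rfl⟩, h0⟩ := h
    have hm : m ≠ 0 := by omega
    have hz := hasSum_zeta_nat hm
    rw [← two_mul] at *
    have hle : ∑' n : ℕ, 1 / (n:ℝ) ^ (2 * m) ≤ ∑' n : ℕ, 1 / (n:ℝ) ^ (2 * 1) := by
      refine hz.summable.tsum_le_tsum (fun n => ?_) hs
      rcases n with _ | n
      · simp [hm]
      · have : (1:ℝ) ≤ ((n+1:ℕ):ℝ) := by push_cast; linarith [Nat.cast_nonneg (α := ℝ) n]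
        gcongr
        omega
    have hnn : 0 ≤ ∑' n : ℕ, 1 / (n:ℝ) ^ (2 * m) := tsum_nonneg fun n => by positivity
    have e := congrArg abs hz.tsum_eq
    rw [abs_of_nonneg hnn] at e
    have e2 : |(bernoulli (2*m) : ℝ)| / (2*m).factorial * (2 * Real.pi) ^ (2*m) = 2 * ∑' n : ℕ, 1 / (n:ℝ) ^ (2 * m) := by
      rw [e]
      obtain ⟨j, hj⟩ : ∃ j, 2 * m = j + 1 := ⟨2*m-1, by omega⟩
      rw [hj]
      simp only [abs_div, abs_mul, abs_pow, abs_neg, abs_one, one_pow, one_mul, Nat.add_sub_cancel, Nat.abs_cast, Nat.abs_ofNat, abs_of_pos hpi]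
      ring
    rw [abs_div, abs_of_nonneg (by positivity : (0:ℝ) ≤ ((2*m).factorial : ℝ) * ((2*m : ℕ):ℝ))]
    refine le_trans ?_ (e2.le.trans (by linarith))
    gcongr
    have : (1:ℝ) ≤ ((2*m : ℕ):ℝ) := by exact_mod_cast (by omega : 1 ≤ 2*m)
    exact le_mul_of_one_le_right (by positivity) this
  · simp; positivity

lemma matrix_eq_exp {n : ℕ} (A : Matrix (Fin n) (Fin n) ℝ) (hA : ‖A‖ < 2 * Real.pi) :
    ∑' k, PowerSeries.coeff k fS • A ^ k = NormedSpace.exp (∑' k, PowerSeries.coeff k gS • A ^ k) := by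
  obtain ⟨D, hD⟩ := gS_bound
  have hR : 0 < 2 * Real.pi := by positivity
  let S := Algebra.elemental ℝ A
  let _ : NormedCommRing S :=
    { (inferInstance : NormedRing S) with mul_comm := fun x y => mul_comm x y }
  let a : S := ⟨A, Algebra.elemental.self_mem ℝ A⟩
  have ha : ‖a‖ < 2 * Real.pi := hA
  have hf0 : PowerSeries.coeff 0 fS = 1 := by simp [fS]
  have hg0 : PowerSeries.coeff 0 gS = 0 := by simp [gS]
  have hc : Continuous (S.val : S → Matrix (Fin n) (Fin n) ℝ) := continuous_subtype_val
  exact ev_eq_exp_map (𝔸 := S) fS_bound hD hf0 hg0 formal_ode a ha S.val hc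

/-- The identity `log q(A) = ∑_{k ≥ 1} b_{2k}·tr(A^{2k})/((2k)!·2k)` of §2.3.2 of the paper,
where `q(A) = det(sinh(A/2)/(A/2))`, for a real matrix `A` of operator norm `< 2π`;
the right-hand series converges absolutely. -/
theorem log_det_sinch_eq_bernoulli_trace_series
    (n : ℕ) (hn : 1 ≤ n) (A : Matrix (Fin n) (Fin n) ℝ) (hA : ‖A‖ < 2 * Real.pi) :
    0 < (∑' k : ℕ, ((1 : ℝ) / (4 ^ k * (2 * k + 1).factorial)) • A ^ (2 * k)).det ∧
    Summable (fun k : ℕ =>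
      ((bernoulli (2 * k + 2) : ℝ) / ((2 * k + 2).factorial * (2 * k + 2)))
        * Matrix.trace (A ^ (2 * k + 2))) ∧
    Real.log (∑' k : ℕ, ((1 : ℝ) / (4 ^ k * (2 * k + 1).factorial)) • A ^ (2 * k)).det
      = ∑' k : ℕ,
          ((bernoulli (2 * k + 2) : ℝ) / ((2 * k + 2).factorial * (2 * k + 2)))
            * Matrix.trace (A ^ (2 * k + 2)) := by
  obtain ⟨D, hD⟩ := gS_bound
  have hR : 0 < 2 * Real.pi := by positivity
  have hsg : Summable fun k => PowerSeries.coeff k gS • A ^ k :=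
    ((growthLe_of_bdd hR hD).summable hA).of_norm
  have hinj1 : Function.Injective (fun k : ℕ => 2 * k) := fun x y h => by
    simpa using h
  have hinj2 : Function.Injective (fun k : ℕ => 2 * k + 2) := fun x y h => by
    simpa using h
  have hF : ∑' k : ℕ, ((1 : ℝ) / (4 ^ k * (2 * k + 1).factorial)) • A ^ (2 * k)
      = ∑' k, PowerSeries.coeff k fS • A ^ k := by
    rw [← hinj1.tsum_eq (f := fun k => PowerSeries.coeff k fS • A ^ k)]
    · refine tsum_congr fun k => ?_
      simp only [fS, PowerSeries.coeff_mk, even_two_mul, if_true, pow_mul (2:ℝ)]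
      norm_num
    · intro k hk
      by_contra hne
      apply hk
      have : ¬ Even k := fun ⟨m, hm⟩ => hne ⟨m, by simp only []; omega⟩
      simp [fS, this]
  have hG0 : ∀ k ∉ Set.range (fun k : ℕ => 2 * k + 2), PowerSeries.coeff k gS = 0 := by
    intro k hk
    have : ¬ (Even k ∧ k ≠ 0) := fun ⟨⟨m, hm⟩, h0⟩ => hk ⟨m - 1, by simp only []; omega⟩
    simp only [gS, PowerSeries.coeff_mk, if_neg this]
  have htr : HasSum (fun k => PowerSeries.coeff k gS * (A ^ k).trace)
      (∑' k, PowerSeries.coeff k gS • A ^ k).trace := by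
    have := hsg.hasSum.map (Matrix.traceLinearMap (Fin n) ℝ ℝ)
      (LinearMap.continuous_of_finiteDimensional _)
    simpa [Function.comp_def] using this
  have htr2 : HasSum (fun k : ℕ =>
      ((bernoulli (2 * k + 2) : ℝ) / ((2 * k + 2).factorial * (2 * k + 2)))
        * Matrix.trace (A ^ (2 * k + 2))) (∑' k, PowerSeries.coeff k gS • A ^ k).trace := by
    rw [← hinj2.hasSum_iff (fun k hk => by rw [hG0 k hk, zero_mul])] at htr
    refine htr.congr_fun ?_
    intro k
    have : Even (2 * k + 2) ∧ 2 * k + 2 ≠ 0 := ⟨⟨k+1, by ring⟩, by omega⟩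
    simp only [gS, PowerSeries.coeff_mk, if_pos this, Function.comp]
    push_cast; rfl
  rw [hF, matrix_eq_exp A hA, det_exp_real, Real.log_exp, htr2.tsum_eq]
  exact ⟨Real.exp_pos _, htr2.summable, rfl⟩
end

section
/- Let n ≥ 1 and let A be an n×n real matrix whose operator norm satisfies ‖A‖ < 2π. For s ∈ (0,1] set h(s) = (1/2)·log det( ∑_{k=0}^∞ ((−1)^k·s^k/(k+1)!)·A^k ) (the determinant is positive for all such s). Then for every t ∈ (0,1], h is differentiable at t with h'(t) = (1/2)·∑_{k=1}^∞ (b_k/k!)·t^{k−1}·tr(A^k), the series converging absolutely. -/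
attribute [local instance] Matrix.linftyOpNormedAddCommGroup Matrix.linftyOpNormedRing
  Matrix.linftyOpNormedAlgebra

open Finset in
lemma bern_conv (m : ℕ) :
    ∑ kl ∈ antidiagonal m, ((-1 : ℝ) ^ kl.1 / (kl.1 + 1).factorial) *
      ((bernoulli kl.2 : ℝ) / (kl.2).factorial) = (-1) ^ m / m.factorial := by
  have h := bernoulli'_spec' m
  have h2 := congrArg (fun q : ℚ => (q : ℝ) * ((-1) ^ m / m.factorial)) h
  simp only [Rat.cast_one, one_mul] at h2
  rw [← h2, Rat.cast_sum, Finset.sum_mul, ← Finset.Nat.sum_antidiagonal_swap]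
  refine Finset.sum_congr rfl fun x hx => ?_
  rw [HasAntidiagonal.mem_antidiagonal] at hx
  obtain ⟨a, b⟩ := x
  simp only [Prod.swap] at hx ⊢
  subst hx
  have hc : ((a + b).choose b : ℝ) = (a + b).factorial / (a.factorial * b.factorial) := by
    rw [← Nat.choose_symm_add, Nat.cast_add_choose]
  push_cast
  rw [hc, bernoulli, Nat.factorial_succ]
  have h1 := Nat.factorial_ne_zero a
  have h2 := Nat.factorial_ne_zero b
  have h3 := Nat.factorial_ne_zero (a+b)
  push_cast
  have : ((b:ℝ)+1) ≠ 0 := by positivity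
  field_simp
  ring

lemma bern_bound (k : ℕ) : |(bernoulli k : ℝ) / k.factorial| ≤ 4 / (2 * Real.pi) ^ k := by
  have hpi := Real.pi_lt_d2
  have hpi0 := Real.pi_gt_three
  rcases Nat.even_or_odd' k with ⟨m, rfl | rfl⟩
  · rcases Nat.eq_zero_or_pos m with rfl | hm
    · norm_num
    have h := hasSum_zeta_nat hm.ne'
    have h2 := hasSum_zeta_two
    have hle := hasSum_le (fun n : ℕ => ?_) h h2
    swap
    · rcases Nat.eq_zero_or_pos n with rfl | hn
      · simp [hm.ne']
      have : (1:ℝ) ≤ n := by exact_mod_cast hn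
      gcongr 1 / ?_
      exact pow_le_pow_right₀ this (by omega)
    have h0 := hasSum_le (fun n : ℕ => (by positivity : (0:ℝ) ≤ 1 / (n : ℝ) ^ (2 * m))) hasSum_zero h
    rw [le_div_iff₀ (by positivity)]
    have e : (-1 : ℝ) ^ (m + 1) * (2 : ℝ) ^ (2 * m - 1) * Real.pi ^ (2 * m) *
        bernoulli (2 * m) / (2 * m).factorial = (-1) ^ (m+1) *
          ((bernoulli (2*m) : ℝ) / (2*m).factorial * (2 * Real.pi) ^ (2*m) / 2) := by
      obtain ⟨p, rfl⟩ : ∃ p, m = p + 1 := ⟨m - 1, by omega⟩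
      rw [show 2 * (p+1) - 1 = 2 * p + 1 by omega, mul_pow, show 2 * (p+1) = 2*p+1+1 by ring]
      rw [pow_succ (2:ℝ) (2*p+1)]
      field_simp
    rw [e] at hle h0
    have e2 : |(bernoulli (2*m) : ℝ) / (2*m).factorial| * (2 * Real.pi) ^ (2*m) / 2 =
      |(-1) ^ (m+1) * ((bernoulli (2*m) : ℝ) / (2*m).factorial * (2 * Real.pi) ^ (2*m) / 2)| := by
      rw [abs_mul ((-1) ^ (m+1)), abs_neg_one_pow, one_mul, abs_div _ (2:ℝ), abs_mul, abs_two,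
        abs_of_nonneg (by positivity : 0 ≤ (2 * Real.pi) ^ (2*m))]
    rw [abs_of_nonneg h0] at e2
    nlinarith
  · rcases Nat.eq_zero_or_pos m with rfl | hm
    · rw [le_div_iff₀ (by positivity)]
      norm_num [bernoulli_one, abs_of_pos]
      linarith
    · rw [bernoulli_eq_zero_of_odd ⟨m, rfl⟩ (by omega)]
      simp only [Rat.cast_zero, zero_div, abs_zero]; positivity

set_option linter.unusedSectionVars false

section alg
variable {𝔸 : Type*} [NormedRing 𝔸] [NormedAlgebra ℝ 𝔸] [CompleteSpace 𝔸] [NormOneClass 𝔸]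

lemma E_norm_summable (A : 𝔸) (s : ℝ) :
    Summable fun k : ℕ => ‖((-1 : ℝ) ^ k * s ^ k / (k + 1).factorial) • A ^ k‖ := by
  refine Summable.of_nonneg_of_le (fun _ => norm_nonneg _) (fun k => ?_)
    (Real.summable_pow_div_factorial (|s| * ‖A‖))
  rw [norm_smul, norm_div, norm_mul, norm_pow, norm_pow, norm_neg, norm_one, one_pow, one_mul,
    mul_pow, Real.norm_eq_abs, Real.norm_natCast, div_mul_eq_mul_div]
  gcongr
  · exact norm_pow_le A k
  · omega

lemma exp_norm_summable (A : 𝔸) (s : ℝ) :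
    Summable fun k : ℕ => ‖((-1 : ℝ) ^ k * s ^ k / k.factorial) • A ^ k‖ := by
  refine Summable.of_nonneg_of_le (fun _ => norm_nonneg _) (fun k => ?_)
    (Real.summable_pow_div_factorial (|s| * ‖A‖))
  rw [norm_smul, norm_div, norm_mul, norm_pow, norm_pow, norm_neg, norm_one, one_pow, one_mul,
    mul_pow, Real.norm_eq_abs, Real.norm_natCast, div_mul_eq_mul_div]
  gcongr
  exact norm_pow_le A k

lemma B_norm_summable (A : 𝔸) (hA : ‖A‖ < 2 * Real.pi) (s : ℝ) (hs : |s| ≤ 1) :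
    Summable fun k : ℕ => ‖((bernoulli k : ℝ) / k.factorial * s ^ k) • A ^ k‖ := by
  have hr : ‖A‖ / (2 * Real.pi) < 1 := by rw [div_lt_one (by positivity)]; exact hA
  refine Summable.of_nonneg_of_le (fun _ => norm_nonneg _) (fun k => ?_)
    ((summable_geometric_of_lt_one (by positivity) hr).mul_left 4)
  rw [norm_smul, norm_mul, norm_pow, Real.norm_eq_abs, Real.norm_eq_abs]
  calc _ ≤ (4 / (2 * Real.pi) ^ k * 1 ^ k) * ‖A‖ ^ k := by
        gcongr
        · exact bern_bound k
        · exact norm_pow_le A k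
    _ = _ := by rw [div_pow]; ring

lemma exp_tsum (A : 𝔸) (s : ℝ) :
    ∑' k : ℕ, ((-1 : ℝ) ^ k * s ^ k / k.factorial) • A ^ k = NormedSpace.exp ((-s) • A) := by
  rw [NormedSpace.exp_eq_tsum ℝ]
  refine tsum_congr fun k => ?_
  rw [smul_pow, smul_smul, neg_pow s, div_eq_inv_mul]

lemma E_mul_B (A : 𝔸) (hA : ‖A‖ < 2 * Real.pi) (s : ℝ) (hs : |s| ≤ 1) :
    (∑' k : ℕ, ((-1 : ℝ) ^ k * s ^ k / (k + 1).factorial) • A ^ k) *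
      (∑' k : ℕ, ((bernoulli k : ℝ) / k.factorial * s ^ k) • A ^ k) =
    ∑' k : ℕ, ((-1 : ℝ) ^ k * s ^ k / k.factorial) • A ^ k := by
  rw [tsum_mul_tsum_eq_tsum_sum_antidiagonal_of_summable_norm (E_norm_summable A s)
    (B_norm_summable A hA s hs)]
  refine tsum_congr fun m => ?_
  have := bern_conv m
  rw [mul_div_right_comm, ← this, Finset.sum_mul, Finset.sum_smul]
  refine Finset.sum_congr rfl fun x hx => ?_
  rw [Finset.HasAntidiagonal.mem_antidiagonal] at hx
  rw [smul_mul_smul_comm, ← pow_add, hx, ← hx, pow_add s]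
  congr 1
  ring

lemma E_hasDeriv (A : 𝔸) (t : ℝ) (ht : |t| < 2) :
    HasDerivAt (fun s : ℝ => ∑' k : ℕ, ((-1 : ℝ) ^ k * s ^ k / (k + 1).factorial) • A ^ k)
      (∑' k : ℕ, ((-1 : ℝ) ^ k * (k * t ^ (k - 1)) / (k + 1).factorial) • A ^ k) t := by
  refine hasDerivAt_tsum_of_isPreconnected (t := Metric.ball (0:ℝ) 2) (y₀ := 0)
    (u := fun k : ℕ => (2 * ‖A‖) ^ k / k.factorial)
    (g' := fun (k : ℕ) (t : ℝ) => ((-1 : ℝ) ^ k * (k * t ^ (k - 1)) / (k + 1).factorial) • A ^ k)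
    (Real.summable_pow_div_factorial _) Metric.isOpen_ball
    (convex_ball _ _).isPreconnected ?_ ?_ (by simp) (E_norm_summable A 0).of_norm (by simpa using ht)
  · intro k y _
    exact (((hasDerivAt_pow k y).const_mul _).div_const _).smul_const _
  · intro k y hy
    have hy : |y| < 2 := by simpa using hy
    rw [norm_smul, norm_div, norm_mul, norm_pow, norm_mul, norm_pow, norm_neg, norm_one, one_pow,
      one_mul, Real.norm_eq_abs y, Real.norm_natCast, Real.norm_natCast, mul_pow, Nat.factorial_succ]
    have h1 : |y| ^ (k-1) ≤ 2 ^ k := by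
      calc |y| ^ (k-1) ≤ 2 ^ (k-1) := by gcongr
        _ ≤ 2 ^ k := by gcongr <;> norm_num
    calc _ ≤ ((k+1:ℕ) * 2 ^ k / ((k+1) * k.factorial : ℕ)) * ‖A‖ ^ k := by
          gcongr
          · omega
          · exact norm_pow_le A k
      _ = _ := by push_cast; field_simp

lemma E_deriv_eq (A : 𝔸) (t : ℝ) :
    t • (∑' k : ℕ, ((-1 : ℝ) ^ k * (k * t ^ (k - 1)) / (k + 1).factorial) • A ^ k) =
    (∑' k : ℕ, ((-1 : ℝ) ^ k * t ^ k / k.factorial) • A ^ k) -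
      ∑' k : ℕ, ((-1 : ℝ) ^ k * t ^ k / (k + 1).factorial) • A ^ k := by
  rw [← (exp_norm_summable A t).of_norm.tsum_sub (E_norm_summable A t).of_norm, ← tsum_const_smul'']
  refine tsum_congr fun k => ?_
  rw [← sub_smul, smul_smul]
  congr 1
  rw [Nat.factorial_succ]
  rcases k with _ | k
  · simp
  · push_cast
    have : ((k:ℝ)+1+1) ≠ 0 := by positivity
    field_simp
    ring

end alg

lemma det_hasDeriv {n : ℕ} (F : ℝ → Matrix (Fin n) (Fin n) ℝ) (M : Matrix (Fin n) (Fin n) ℝ)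
    (t : ℝ) (hF : HasDerivAt F M t) (h1 : F t = 1) :
    HasDerivAt (fun s => (F s).det) M.trace t := by
  have key : ∀ (G : ℝ → Matrix (Fin n) (Fin n) ℝ) (t : ℝ), HasDerivAt G M t → G t = 1 →
     HasDerivAt (fun s => (G s).det) (∑ σ : Equiv.Perm (Fin n), ((Equiv.Perm.sign σ : ℤ) : ℝ) *
       ∑ i, (∏ j ∈ Finset.univ.erase i, (1 : Matrix (Fin n) (Fin n) ℝ) (σ j) j) • M (σ i) i) t := by
    intro G t hG hG1
    simp only [Matrix.det_apply']
    refine HasDerivAt.fun_sum fun σ _ => ?_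
    refine HasDerivAt.const_mul _ ?_
    rw [← hG1]
    refine HasDerivAt.fun_finsetProd fun i _ => ?_
    exact ((LinearMap.toContinuousLinearMap
      (Matrix.entryLinearMap ℝ ℝ (σ i) i)).hasFDerivAt.comp_hasDerivAt t hG)
  have k1 := key F t hF h1
  have k2 := key (fun r : ℝ => 1 + r • M) 0 (by
    have := ((hasDerivAt_id (0:ℝ)).smul_const M).const_add 1
    rw [one_smul] at this
    exact this) (by simp)
  have k3 : HasDerivAt (fun r : ℝ => (1 + r • M).det) M.trace 0 := by
    rw [funext fun r : ℝ => Matrix.det_one_add_smul r M]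
    have := (((hasDerivAt_id (0:ℝ)).const_mul M.trace).const_add 1).add
      ((Polynomial.hasDerivAt (Polynomial.divX (Polynomial.divX
        (Matrix.det (1 + (Polynomial.X : Polynomial ℝ) • M.map Polynomial.C)))) 0).mul (hasDerivAt_pow 2 (0:ℝ)))
    exact this.congr_deriv (by simp)
  rwa [k2.unique k3] at k1

/-- Equation (11) of the paper: for a real matrix `A` of operator norm `< 2π`, the
function `h(s) = ½·log det((1 - e^{-sA})/(sA))` on `(0,1]` (the determinant being
positive there) has derivative `h'(t) = ½·∑_{k ≥ 1} (b_k/k!)·t^{k-1}·tr(A^k)`, the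
series converging absolutely. -/
theorem deriv_log_det_jacobian_exp
    (n : ℕ) (hn : 1 ≤ n) (A : Matrix (Fin n) (Fin n) ℝ) (hA : ‖A‖ < 2 * Real.pi) :
    (∀ s ∈ Set.Ioc (0 : ℝ) 1,
      0 < (∑' k : ℕ, ((-1 : ℝ) ^ k * s ^ k / (k + 1).factorial) • A ^ k).det) ∧
    ∀ t ∈ Set.Ioc (0 : ℝ) 1,
      Summable (fun k : ℕ =>
        ((bernoulli (k + 1) : ℝ) / (k + 1).factorial) * t ^ k * Matrix.trace (A ^ (k + 1))) ∧
      HasDerivWithinAt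
        (fun s : ℝ =>
          (1 / 2) * Real.log (∑' k : ℕ, ((-1 : ℝ) ^ k * s ^ k / (k + 1).factorial) • A ^ k).det)
        ((1 / 2) * ∑' k : ℕ,
          ((bernoulli (k + 1) : ℝ) / (k + 1).factorial) * t ^ k * Matrix.trace (A ^ (k + 1)))
        (Set.Ioc (0 : ℝ) 1) t := by
  have : Nonempty (Fin n) := ⟨⟨0, hn⟩⟩
  have : CompleteSpace (Matrix (Fin n) (Fin n) ℝ) := FiniteDimensional.complete ℝ _
  set E : ℝ → Matrix (Fin n) (Fin n) ℝ := fun s =>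
    ∑' k : ℕ, ((-1 : ℝ) ^ k * s ^ k / (k + 1).factorial) • A ^ k with hE
  set B : ℝ → Matrix (Fin n) (Fin n) ℝ := fun s =>
    ∑' k : ℕ, ((bernoulli k : ℝ) / k.factorial * s ^ k) • A ^ k with hB
  have hEB : ∀ s : ℝ, |s| ≤ 1 → E s * B s = NormedSpace.exp ((-s) • A) := fun s hs =>
    (E_mul_B A hA s hs).trans (exp_tsum A s)
  have hunit : ∀ s : ℝ, |s| ≤ 1 → (E s).det ≠ 0 := by
    intro s hs h0
    have h1 : IsUnit (NormedSpace.exp ((-s) • A)) := NormedSpace.isUnit_exp _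
    rw [← hEB s hs, Matrix.isUnit_iff_isUnit_det, Matrix.det_mul, h0, zero_mul] at h1
    exact not_isUnit_zero h1
  have hE0 : E 0 = 1 := by
    simp only [hE]
    rw [tsum_eq_single 0]
    · simp
    · intro k hk
      simp [hk]
  have hcont : ContinuousOn (fun s => (E s).det) (Set.Icc 0 1) := by
    intro s hs
    have h := (E_hasDeriv A s (by rw [abs_of_nonneg hs.1]; linarith [hs.2])).continuousAt
    have h2 : Continuous (fun M : Matrix (Fin n) (Fin n) ℝ => M.det) := continuous_id.matrix_det
    exact (h2.continuousAt.comp h).continuousWithinAt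
  have hpos : ∀ s ∈ Set.Icc (0:ℝ) 1, 0 < (E s).det := by
    intro s hs
    by_contra hneg
    have hneg : (E s).det ≤ 0 := not_lt.mp hneg
    have hsub : Set.Icc 0 s ⊆ Set.Icc (0:ℝ) 1 := Set.Icc_subset_Icc_right hs.2
    have := intermediate_value_Icc' hs.1 (hcont.mono hsub)
    obtain ⟨x, hx, hx0⟩ := this (show (0:ℝ) ∈ _ from ⟨hneg, by simp [hE0]⟩)
    exact hunit x (by rw [abs_of_nonneg hx.1]; exact (hsub hx).2) hx0
  refine ⟨fun s hs => hpos s ⟨hs.1.le, hs.2⟩, fun t ht => ?_⟩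
  have ht1 : |t| ≤ 1 := by rw [abs_of_pos ht.1]; exact ht.2
  have ht0 : t ≠ 0 := ht.1.ne'
  have hBs : HasSum (fun k : ℕ => ((bernoulli k : ℝ) / k.factorial * t ^ k) • A ^ k) (B t) :=
    (B_norm_summable A hA t ht1).of_norm.hasSum
  have hTr : HasSum (fun k : ℕ => (((bernoulli k : ℝ) / k.factorial * t ^ k) • A ^ k).trace)
      (B t).trace := (LinearMap.toContinuousLinearMap (Matrix.traceLinearMap (Fin n) ℝ ℝ)).hasSum hBs
  have hTr1 := (hasSum_nat_add_iff' 1).mpr hTr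
  have hTr2 := hTr1.mul_left t⁻¹
  have hser : HasSum (fun k : ℕ =>
        ((bernoulli (k + 1) : ℝ) / (k + 1).factorial) * t ^ k * Matrix.trace (A ^ (k + 1)))
      (t⁻¹ * ((B t).trace - (1 : Matrix (Fin n) (Fin n) ℝ).trace)) := by
    simp only [Finset.sum_range_one, Matrix.trace_smul, smul_eq_mul, bernoulli_zero, Rat.cast_one,
      Nat.factorial_zero, Nat.cast_one, div_one, pow_zero, mul_one, one_mul] at hTr2
    refine HasSum.congr_fun hTr2 ?_
    intro k
    rw [pow_succ t]
    field_simp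
  refine ⟨hser.summable, ?_⟩
  rw [hser.tsum_eq]
  have ht2 : |t| < 2 := by linarith
  have hd := E_hasDeriv A t ht2
  set E' := ∑' k : ℕ, ((-1 : ℝ) ^ k * (k * t ^ (k - 1)) / (k + 1).factorial) • A ^ k with hE'
  have hE'eq : t • E' = E t * B t - E t :=
    (E_deriv_eq A t).trans (congrArg (fun X => X - E t) (E_mul_B A hA t ht1).symm)
  have hu : IsUnit (E t).det := (hunit t ht1).isUnit
  have hF : HasDerivAt (fun s => (E t)⁻¹ * E s) ((E t)⁻¹ * E') t := hd.const_mul _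
  have hdet := det_hasDeriv _ _ t hF (Matrix.nonsing_inv_mul _ hu)
  have hM : ((E t)⁻¹ * E').trace = t⁻¹ * ((B t).trace - (1 : Matrix (Fin n) (Fin n) ℝ).trace) := by
    have h3 : t • ((E t)⁻¹ * E') = B t - 1 := by
      rw [← Matrix.mul_smul, hE'eq, Matrix.mul_sub, Matrix.nonsing_inv_mul _ hu, ← Matrix.mul_assoc,
        Matrix.nonsing_inv_mul _ hu, Matrix.one_mul]
    have h4 := congrArg Matrix.trace h3
    rw [Matrix.trace_smul, Matrix.trace_sub, smul_eq_mul] at h4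
    rw [← h4, inv_mul_cancel_left₀ ht0]
  rw [hM] at hdet
  have hdet2 := hdet.const_mul (E t).det
  have hfun : (fun s => (E t).det * ((E t)⁻¹ * E s).det) = fun s => (E s).det := by
    funext s
    rw [← Matrix.det_mul, ← Matrix.mul_assoc, Matrix.mul_nonsing_inv _ hu, Matrix.one_mul]
  rw [hfun] at hdet2
  have hlog := (hdet2.log (hunit t ht1)).const_mul (1 / 2)
  rw [mul_div_cancel_left₀ _ (hunit t ht1)] at hlog
  exact hlog.hasDerivWithinAt
end
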